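/- A function F : ℝ^n → [0,1] is a joint cumulative distribution function with one-dimensional marginal cdfs F_1,…,F_n and absolutely continuous with respect to the product ∏_{k=1}^n F_k if and only if there exist Borel functions g̃_{i_1,…,i_c} : [0,1]^c → ℝ, 1 ≤ i_1 < ⋯ < i_c ≤ n, c = 2,…,n, satisfying conditions A4–A6 and such that F(x_1,…,x_n) = ∫_0^{F_1(x_1)}⋯∫_0^{F_n(x_n)} (1 + Ũ_n(t_1,…,t_n)) dt_1⋯dt_n, where Ũ_n(t_1,…,t_n) = Σ_{c=2}^{n} Σ_{1≤i_1<⋯<i_c≤n} g̃_{i_1,…,i_c}(t_{i_1},…,t_{i_c}). -/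

import Mathlib

open MeasureTheory Finset

/-- A function `g` on `ℝⁿ` depends only on the coordinates in `S`
(i.e., it is really a function of the variables `x_i`, `i ∈ S`). -/
def DependsOnlyOn {n : ℕ} (S : Finset (Fin n)) (g : (Fin n → ℝ) → ℝ) : Prop :=
  ∀ x y : Fin n → ℝ, (∀ i ∈ S, x i = y i) → g x = g y

/-- The sum of U-statistics `U_n(x) = Σ_{c=2}^n Σ_{i_1<⋯<i_c} g_{i_1,…,i_c}(x_{i_1},…,x_{i_c})`,
where the kernel for the index set `S = {i_1,…,i_c}` is `g S`. -/
noncomputable def Usum {n : ℕ} (g : Finset (Fin n) → (Fin n → ℝ) → ℝ) (x : Fin n → ℝ) : ℝ :=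
  ∑ S ∈ Finset.univ.filter (fun S : Finset (Fin n) => 2 ≤ S.card), g S x

/-- Conditions A1 (integrability), A2 (degeneracy: zero mean in each argument, a.s. in
the remaining arguments) and A3 (positive definiteness: `U_n ≥ -1` a.s.) for a family of
Borel kernels `g_{i_1,…,i_c}`, with respect to independent random variables `ξ_1,…,ξ_n`
with distributions `μ_1,…,μ_n` (whose joint law is `Measure.pi μ`). -/
def IsKernelSystem {n : ℕ} (μ : Fin n → Measure ℝ) (g : Finset (Fin n) → (Fin n → ℝ) → ℝ) :
    Prop :=
  (∀ S : Finset (Fin n), 2 ≤ S.card →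
      Measurable (g S) ∧ DependsOnlyOn S (g S) ∧
      Integrable (g S) (Measure.pi μ) ∧
      ∀ k ∈ S, ∀ᵐ x ∂Measure.pi μ, ∫ t, g S (Function.update x k t) ∂μ k = 0) ∧
  (∀ᵐ x ∂Measure.pi μ, -1 ≤ Usum g x)

/-- The uniform distribution on `[0,1]`: the law of each `V_i`. -/
noncomputable def unifMeasure : Measure ℝ := volume.restrict (Set.Icc (0 : ℝ) 1)

section HoeffdingDecomposition

open scoped ENNReal

/-- The Möbius transform `S ↦ ∑_{T ⊆ S} (-1)^{|S| + |T|} a T` of a set function. -/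
def mobiusSum {ι : Type*} (a : Finset ι → ℝ) (S : Finset ι) : ℝ :=
  ∑ T ∈ S.powerset, (-1) ^ (S.card + T.card) * a T

lemma mobiusSum_empty {ι : Type*} (a : Finset ι → ℝ) : mobiusSum a ∅ = a ∅ := by
  simp [mobiusSum]

lemma mobiusSum_insert {ι : Type*} [DecidableEq ι] (a : Finset ι → ℝ) {k : ι} {S : Finset ι}
    (hk : k ∉ S) :
    mobiusSum a (insert k S) = mobiusSum (fun T => a (insert k T)) S - mobiusSum a S := by
  have hT : ∀ T ∈ S.powerset, k ∉ T := fun T hT hkT => hk (mem_powerset.mp hT hkT)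
  rw [mobiusSum, sum_powerset_insert hk, mobiusSum, mobiusSum, add_comm, sub_eq_add_neg,
    ← sum_neg_distrib]
  congr 1
  · refine sum_congr rfl fun T h => ?_
    rw [card_insert_of_notMem hk, card_insert_of_notMem (hT T h)]
    ring
  · refine sum_congr rfl fun T h => ?_
    rw [card_insert_of_notMem hk]
    ring

/-- Möbius inversion on the lattice of finite subsets. -/
lemma sum_powerset_mobiusSum {ι : Type*} [DecidableEq ι] (a : Finset ι → ℝ) (U : Finset ι) :
    ∑ S ∈ U.powerset, mobiusSum a S = a U := by
  induction U using Finset.induction generalizing a with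
  | empty => simp [mobiusSum_empty]
  | insert k U hk ih =>
    rw [sum_powerset_insert hk, ih]
    have h : ∀ S ∈ U.powerset, mobiusSum a (insert k S) =
        mobiusSum (fun T => a (insert k T)) S - mobiusSum a S :=
      fun S hS => mobiusSum_insert a fun hkS => hk (mem_powerset.mp hS hkS)
    rw [sum_congr rfl h, sum_sub_distrib, ih, ih]
    ring

variable {ι : Type*} [DecidableEq ι] {X : ι → Type*} [∀ i, MeasurableSpace (X i)]

lemma lmarginal_comp {Y : ι → Type*} [∀ i, MeasurableSpace (Y i)] {μ : ∀ i, Measure (X i)}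
    {ν : ∀ i, Measure (Y i)} [∀ i, IsProbabilityMeasure (ν i)] {q : ∀ i, X i → Y i}
    (hq : ∀ i, MeasurePreserving (q i) (μ i) (ν i)) (s : Finset ι) {f : (∀ i, Y i) → ℝ≥0∞}
    (hf : Measurable f) (x : ∀ i, X i) :
    lmarginal μ s (fun x => f fun i => q i (x i)) x = lmarginal ν s f fun i => q i (x i) := by
  have hmp := measurePreserving_pi (fun i : s => μ i) (fun i : s => ν i) fun i => hq i
  rw [lmarginal, lmarginal, ← hmp.lintegral_comp
    (f := fun y => f (Function.updateFinset (fun i => q i (x i)) s y))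
    (hf.comp measurable_updateFinset)]
  refine lintegral_congr fun y => congrArg f ?_
  ext i
  by_cases hi : i ∈ s <;> simp [Function.updateFinset, hi]

variable [Fintype ι]

lemma lintegral_lmarginal (μ : ∀ i, Measure (X i)) [∀ i, IsProbabilityMeasure (μ i)]
    (s : Finset ι) {f : (∀ i, X i) → ℝ≥0∞} (hf : Measurable f) :
    ∫⁻ x, lmarginal μ s f x ∂Measure.pi μ = ∫⁻ x, f x ∂Measure.pi μ := by
  refine lintegral_eq_of_lmarginal_eq s (hf.lmarginal μ) hf ?_
  ext x
  rw [lmarginal]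
  have h : ∀ y, lmarginal μ s f (Function.updateFinset x s y) = lmarginal μ s f x := fun y =>
    lmarginal_congr μ f fun i hi => by simp [Function.updateFinset, hi]
  simp [h]

/-- A density whose `i`-th one-dimensional marginal is `μ i` integrates to one over the
coordinates other than `i`. -/
lemma lmarginal_compl_singleton_ae_eq_one {μ : ∀ i, Measure (X i)}
    [∀ i, IsProbabilityMeasure (μ i)] {f : (∀ i, X i) → ℝ≥0∞} (hf : Measurable f) (i : ι)
    (h : ((Measure.pi μ).withDensity f).map (fun x => x i) = μ i) :
    ∀ᵐ x ∂Measure.pi μ, lmarginal μ {i}ᶜ f x = 1 := by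
  have hne : ∀ j, Nonempty (X j) := fun j => nonempty_of_isProbabilityMeasure (μ j)
  let x₀ : ∀ j, X j := fun j => (hne j).some
  let φ : X i → ℝ≥0∞ := fun t => lmarginal μ {i}ᶜ f (Function.update x₀ i t)
  have hφm : Measurable φ := (hf.lmarginal μ).comp (measurable_update _)
  have hφ : φ =ᵐ[μ i] fun _ => 1 := by
    refine ae_eq_of_forall_setLIntegral_eq_of_sigmaFinite hφm measurable_const
      fun B hB _ => ?_
    have hB' : MeasurableSet ((fun x : ∀ j, X j => x i) ⁻¹' B) := measurable_pi_apply i hB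
    have key : ∀ x : ∀ j, X j, lmarginal μ {i}ᶜ (((fun x => x i) ⁻¹' B).indicator f) x =
        B.indicator (fun _ => lmarginal μ {i}ᶜ f x) (x i) := fun x => by
      by_cases hx : x i ∈ B <;>
        simp [lmarginal, Set.indicator, Function.updateFinset, hx]
    have hins : insert i ({i}ᶜ : Finset ι) = univ := by ext j; simp
    have := lmarginal_insert (μ := μ) (((fun x => x i) ⁻¹' B).indicator f) (hf.indicator hB')
      (i := i) (s := {i}ᶜ) (by simp) x₀
    rw [hins, ← lintegral_eq_lmarginal_univ, lintegral_indicator hB', ← withDensity_apply _ hB',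
      ← Measure.map_apply (measurable_pi_apply i) hB, h] at this
    simp only [key, Function.update_self] at this
    rw [setLIntegral_const, one_mul, this, ← lintegral_indicator hB]
    rfl
  filter_upwards [(Measure.quasiMeasurePreserving_eval μ i).ae hφ] with x hx
  rw [← hx]
  exact lmarginal_congr μ f fun j hj => by
    obtain rfl : j = i := by simpa using hj
    simp

lemma measurePreserving_update (μ : ∀ i, Measure (X i)) [∀ i, IsProbabilityMeasure (μ i)]
    (k : ι) :
    MeasurePreserving (fun p : (∀ i, X i) × X k => Function.update p.1 k p.2)
      ((Measure.pi μ).prod (μ k)) (Measure.pi μ) := by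
  have hm : Measurable fun p : (∀ i, X i) × X k => Function.update p.1 k p.2 := by
    refine measurable_pi_lambda _ fun i => ?_
    by_cases hi : i = k
    · subst hi; simpa using measurable_snd
    · simpa [hi, Function.comp_def] using
        (measurable_pi_apply (X := X) i).comp measurable_fst
  refine ⟨hm, (Measure.pi_eq fun s hs => ?_).symm⟩
  rw [Measure.map_apply hm (MeasurableSet.univ_pi hs)]
  have : (fun p : (∀ i, X i) × X k => Function.update p.1 k p.2) ⁻¹' Set.univ.pi s =
      (Set.univ.pi (Function.update s k Set.univ)) ×ˢ s k := by
    ext p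
    simp only [Set.mem_preimage, Set.mem_pi, Set.mem_univ, true_imp_iff, Set.mem_prod]
    constructor
    · refine fun h => ⟨fun i => ?_, by simpa using h k⟩
      by_cases hi : i = k
      · subst hi; simp
      · simpa [hi] using h i
    · rintro ⟨h, h'⟩ i
      by_cases hi : i = k
      · subst hi; simpa using h'
      · simpa [hi] using h i
  rw [this, Measure.prod_prod, Measure.pi_pi, ← mul_prod_erase univ _ (mem_univ k),
    ← mul_prod_erase univ (fun i => μ i (s i)) (mem_univ k), mul_comm]
  simp only [Function.update_self, measure_univ, one_mul]
  congr 1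
  exact prod_congr rfl fun i hi => by rw [Function.update_of_ne (ne_of_mem_erase hi)]

/-- A function with zero mean in its `k`-th argument integrates to zero over every set that does
not restrict the `k`-th coordinate. -/
lemma setIntegral_eq_zero_of_integral_update_eq_zero {μ : ∀ i, Measure (X i)}
    [∀ i, IsProbabilityMeasure (μ i)] {f : (∀ i, X i) → ℝ} (hf : Integrable f (Measure.pi μ))
    {k : ι} (hk : ∀ᵐ x ∂Measure.pi μ, ∫ t, f (Function.update x k t) ∂μ k = 0)
    {A : Set (∀ i, X i)} (hA : MeasurableSet A)
    (hAk : ∀ x t, Function.update x k t ∈ A ↔ x ∈ A) :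
    ∫ x in A, f x ∂Measure.pi μ = 0 := by
  have hmp := measurePreserving_update μ k
  have hi : Integrable (A.indicator f) (Measure.pi μ) := hf.indicator hA
  rw [← integral_indicator hA, ← hmp.map_eq, integral_map hmp.measurable.aemeasurable
    (by rw [hmp.map_eq]; exact hi.aestronglyMeasurable),
    integral_prod (fun p : (∀ i, X i) × X k => A.indicator f (Function.update p.1 k p.2))
      (hmp.integrable_comp_of_integrable hi)]
  refine integral_eq_zero_of_ae ?_
  filter_upwards [hk] with x hx
  by_cases h : x ∈ A <;> simp [Set.indicator, hAk, h, hx]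

end HoeffdingDecomposition

section KernelSystem

variable {n : ℕ} {μ : Fin n → Measure ℝ}

lemma IsKernelSystem.measurable_one_add_Usum {g : Finset (Fin n) → (Fin n → ℝ) → ℝ}
    (hg : IsKernelSystem μ g) : Measurable (fun x => 1 + Usum g x) :=
  measurable_const.add <|
    Finset.measurable_sum _ fun S hS => (hg.1 S (mem_filter.mp hS).2).1

lemma IsKernelSystem.one_add_Usum_nonneg {g : Finset (Fin n) → (Fin n → ℝ) → ℝ}
    (hg : IsKernelSystem μ g) : ∀ᵐ x ∂Measure.pi μ, 0 ≤ 1 + Usum g x := by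
  filter_upwards [hg.2] with x hx
  linarith

lemma Usum_add_sum_card_lt_two (g : Finset (Fin n) → (Fin n → ℝ) → ℝ) (x : Fin n → ℝ) :
    Usum g x + ∑ S ∈ univ.filter (fun S : Finset (Fin n) => ¬ 2 ≤ S.card), g S x =
      ∑ S, g S x :=
  sum_filter_add_sum_filter_not _ _ _

variable [∀ i, IsProbabilityMeasure (μ i)]

/-- A density with one-dimensional marginals `μ i` has a canonical (Hoeffding) decomposition. -/
theorem exists_isKernelSystem {f : (Fin n → ℝ) → ENNReal} (hf : Measurable f)
    (hone : ∫⁻ x, f x ∂Measure.pi μ = 1)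
    (hmarg : ∀ i, ∀ᵐ x ∂Measure.pi μ, lmarginal μ {i}ᶜ f x = 1) :
    ∃ g, IsKernelSystem μ g ∧ ∀ᵐ x ∂Measure.pi μ, 1 + Usum g x = (f x).toReal := by
  let a : (Fin n → ℝ) → Finset (Fin n) → ℝ := fun x T => (lmarginal μ Tᶜ f x).toReal
  let g : Finset (Fin n) → (Fin n → ℝ) → ℝ := fun S x => mobiusSum (a x) S
  have hlint : ∀ T : Finset (Fin n), ∫⁻ x, lmarginal μ Tᶜ f x ∂Measure.pi μ ≠ ⊤ := fun T => by
    simp [lintegral_lmarginal μ Tᶜ hf, hone]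
  have hfin : ∀ᵐ x ∂Measure.pi μ, ∀ T : Finset (Fin n), lmarginal μ Tᶜ f x < ⊤ :=
    ae_all_iff.mpr fun T => ae_lt_top (hf.lmarginal μ) (hlint T)
  have hsum : ∀ᵐ x ∂Measure.pi μ, 1 + Usum g x = (f x).toReal := by
    filter_upwards [ae_all_iff.mpr hmarg] with x hx
    have hlow : ∑ S ∈ univ.filter (fun S : Finset (Fin n) => ¬ 2 ≤ S.card), g S x = 1 := by
      have hemp : g ∅ x = 1 := by simp [g, a, mobiusSum_empty, hone]
      rw [sum_eq_single_of_mem ∅ (by simp) fun S hS hS0 => ?_, hemp]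
      have hcard : S.card = 1 := by
        have := card_pos.mpr (nonempty_iff_ne_empty.mpr hS0)
        have := (mem_filter.mp hS).2
        omega
      obtain ⟨i, rfl⟩ := card_eq_one.mp hcard
      simp only [g]
      rw [← insert_empty_eq, mobiusSum_insert _ (notMem_empty i), mobiusSum_empty, mobiusSum_empty]
      simp [a, hone, hx]
    have htot : ∑ S, g S x = (f x).toReal := by
      rw [← powerset_univ, sum_powerset_mobiusSum]
      simp [a]
    linarith [Usum_add_sum_card_lt_two g x]
  refine ⟨g, ⟨fun S _ => ⟨?_, ?_, ?_, ?_⟩, ?_⟩, hsum⟩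
  · exact Finset.measurable_sum _ fun T _ => (hf.lmarginal μ).ennreal_toReal.const_mul _
  · refine fun x y hxy => sum_congr rfl fun T hT => ?_
    have : lmarginal μ Tᶜ f x = lmarginal μ Tᶜ f y := lmarginal_congr μ f fun i hi =>
      hxy i (mem_powerset.mp hT (by simpa using hi))
    simp [a, this]
  · exact integrable_finsetSum _ fun T _ =>
      (integrable_toReal_of_lintegral_ne_top (hf.lmarginal μ).aemeasurable (hlint T)).const_mul _
  · intro k hk
    filter_upwards [hfin] with x hx
    obtain ⟨S, hkS, rfl⟩ : ∃ S', k ∉ S' ∧ insert k S' = S :=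
      ⟨S.erase k, notMem_erase k S, insert_erase hk⟩
    have hupd : ∀ T ∈ S.powerset, k ∉ T := fun T hT h => hkS (mem_powerset.mp hT h)
    have hlow : ∀ t, mobiusSum (a (Function.update x k t)) S = mobiusSum (a x) S := fun t =>
      sum_congr rfl fun T hT => by
        simp only [a]
        rw [lmarginal_update_of_mem μ (by simpa using hupd T hT)]
    have hstep : ∀ T ∈ S.powerset,
        ∫⁻ t, lmarginal μ (insert k T)ᶜ f (Function.update x k t) ∂μ k = lmarginal μ Tᶜ f x :=
      fun T hT => by
        rw [lmarginal_erase f hf (i := k) (by simpa using hupd T hT), compl_insert]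
    have hmeas : ∀ T : Finset (Fin n),
        Measurable fun t => lmarginal μ (insert k T)ᶜ f (Function.update x k t) :=
      fun T => (hf.lmarginal μ).comp (measurable_update _)
    have hint : ∀ T ∈ S.powerset, Integrable
        (fun t => (lmarginal μ (insert k T)ᶜ f (Function.update x k t)).toReal) (μ k) :=
      fun T hT => integrable_toReal_of_lintegral_ne_top (hmeas T).aemeasurable
        (by rw [hstep T hT]; exact (hx T).ne)
    have hval : ∀ T ∈ S.powerset,
        ∫ t, (lmarginal μ (insert k T)ᶜ f (Function.update x k t)).toReal ∂μ k = a x T :=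
      fun T hT => by
        rw [integral_toReal (hmeas T).aemeasurable (ae_lt_top (hmeas T)
          (by rw [hstep T hT]; exact (hx T).ne)), hstep T hT]
    have hint' : Integrable
        (fun t => mobiusSum (fun T => a (Function.update x k t) (insert k T)) S) (μ k) :=
      integrable_finsetSum _ fun T hT => (hint T hT).const_mul _
    have hins : ∫ t, mobiusSum (fun T => a (Function.update x k t) (insert k T)) S ∂μ k =
        mobiusSum (a x) S := by
      simp only [mobiusSum, a]
      rw [integral_finsetSum _ fun T hT => (hint T hT).const_mul _]
      exact sum_congr rfl fun T hT => by rw [integral_const_mul, hval T hT]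
    simp only [g, mobiusSum_insert _ hkS, hlow]
    rw [integral_sub hint' (integrable_const _), hins]
    simp
  · filter_upwards [hsum] with x hx
    linarith [ENNReal.toReal_nonneg (a := f x)]

lemma IsKernelSystem.integrable_one_add_Usum {g : Finset (Fin n) → (Fin n → ℝ) → ℝ}
    (hg : IsKernelSystem μ g) : Integrable (fun x => 1 + Usum g x) (Measure.pi μ) :=
  (integrable_const _).add <|
    integrable_finsetSum _ fun S hS => (hg.1 S (mem_filter.mp hS).2).2.2.1

/-- On sets restricting at most one coordinate, `1 + Uₙ` integrates to the product measure. -/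
lemma IsKernelSystem.setLIntegral_one_add_Usum {g : Finset (Fin n) → (Fin n → ℝ) → ℝ}
    (hg : IsKernelSystem μ g) {A : Set (Fin n → ℝ)} (hA : MeasurableSet A)
    (hdep : ∀ S : Finset (Fin n), 2 ≤ S.card →
      ∃ k ∈ S, ∀ x t, Function.update x k t ∈ A ↔ x ∈ A) :
    ∫⁻ x in A, ENNReal.ofReal (1 + Usum g x) ∂Measure.pi μ = Measure.pi μ A := by
  have hint : ∀ S ∈ univ.filter (fun S : Finset (Fin n) => 2 ≤ S.card),
      Integrable (g S) (Measure.pi μ) := fun S hS => (hg.1 S (mem_filter.mp hS).2).2.2.1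
  rw [← ofReal_integral_eq_lintegral_ofReal hg.integrable_one_add_Usum.integrableOn
    (ae_restrict_of_ae hg.one_add_Usum_nonneg)]
  have hzero : ∫ x in A, Usum g x ∂Measure.pi μ = 0 := by
    simp only [Usum]
    rw [integral_finsetSum _ fun S hS => (hint S hS).integrableOn]
    refine sum_eq_zero fun S hS => ?_
    obtain ⟨k, hk, hAk⟩ := hdep S (mem_filter.mp hS).2
    exact setIntegral_eq_zero_of_integral_update_eq_zero (hint S hS)
      ((hg.1 S (mem_filter.mp hS).2).2.2.2 k hk) hA hAk
  have hU : Integrable (fun x => Usum g x) (Measure.pi μ) := integrable_finsetSum _ hint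
  rw [integral_add (integrable_const _) hU.integrableOn, hzero]
  simp

end KernelSystem

section Quantile

instance : IsProbabilityMeasure unifMeasure := ⟨by simp [unifMeasure]⟩

lemma ae_unifMeasure_mem_Ioo : ∀ᵐ t ∂unifMeasure, t ∈ Set.Ioo (0 : ℝ) 1 := by
  rw [unifMeasure, ← restrict_Ioo_eq_restrict_Icc]
  exact ae_restrict_mem measurableSet_Ioo

lemma unifMeasure_Iic {y : ℝ} (h1 : y ≤ 1) :
    unifMeasure (Set.Iic y) = ENNReal.ofReal y := by
  rw [unifMeasure, Measure.restrict_apply measurableSet_Iic]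
  have : Set.Iic y ∩ Set.Icc 0 1 = Set.Icc 0 y := by
    ext t
    simp only [Set.mem_inter_iff, Set.mem_Iic, Set.mem_Icc]
    constructor
    · rintro ⟨h, h', -⟩; exact ⟨h', h⟩
    · rintro ⟨h, h'⟩; exact ⟨h', h, h'.trans h1⟩
  rw [this, Real.volume_Icc, sub_zero]

/-- The quantile function of a distribution on the line. -/
theorem exists_quantile (μ : Measure ℝ) [IsProbabilityMeasure μ] :
    ∃ q : ℝ → ℝ, MeasurePreserving q unifMeasure μ ∧
      ∀ᵐ t ∂unifMeasure, ∀ x, q t ≤ x ↔ t ≤ (μ (Set.Iic x)).toReal := by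
  classical
  have hF : ∀ x, (μ (Set.Iic x)).toReal = ProbabilityTheory.cdf μ x := fun x =>
    (ProbabilityTheory.cdf_eq_real μ x).symm
  simp only [hF]
  set F := ProbabilityTheory.cdf μ
  let q : ℝ → ℝ := fun t => if t ∈ Set.Ioo (0 : ℝ) 1 then sInf {x | t ≤ F x} else 0
  have hq : ∀ t ∈ Set.Ioo (0 : ℝ) 1, ∀ x, q t ≤ x ↔ t ≤ F x := by
    intro t ht x
    have hbdd : BddBelow {x | t ≤ F x} := by
      obtain ⟨b, hb⟩ :=
        ((ProbabilityTheory.tendsto_cdf_atBot μ).eventually (gt_mem_nhds ht.1)).exists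
      exact ⟨b, fun y hy => le_of_not_ge fun hyb => absurd hb
        (not_lt.mpr (le_trans hy (F.mono hyb)))⟩
    have hne : {x | t ≤ F x}.Nonempty := by
      obtain ⟨b, hb⟩ :=
        ((ProbabilityTheory.tendsto_cdf_atTop μ).eventually (lt_mem_nhds ht.2)).exists
      exact ⟨b, hb.le⟩
    simp only [q, if_pos ht]
    refine ⟨fun h => ?_, fun h => csInf_le hbdd h⟩
    have hright : Filter.Tendsto F (nhdsWithin x (Set.Ioi x)) (nhds (F x)) :=
      (F.right_continuous x).mono_left (nhdsWithin_mono _ Set.Ioi_subset_Ici_self)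
    refine ge_of_tendsto hright ?_
    filter_upwards [self_mem_nhdsWithin] with y hy
    obtain ⟨z, hz, hzy⟩ := exists_lt_of_csInf_lt hne (lt_of_le_of_lt h hy)
    exact le_trans hz (F.mono hzy.le)
  have hqm : Measurable q := by
    refine measurable_of_Iic fun x => ?_
    have : q ⁻¹' Set.Iic x = (Set.Ioo (0 : ℝ) 1 ∩ Set.Iic (F x)) ∪
        ((Set.Ioo (0 : ℝ) 1)ᶜ ∩ {_t | (0 : ℝ) ≤ x}) := by
      ext t
      by_cases ht : t ∈ Set.Ioo (0 : ℝ) 1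
      · simp [ht, hq t ht x, -Set.mem_Ioo]
      · simp [ht, q, -Set.mem_Ioo]
    rw [this]
    exact (measurableSet_Ioo.inter measurableSet_Iic).union
      (measurableSet_Ioo.compl.inter (MeasurableSet.const _))
  have hae : ∀ᵐ t ∂unifMeasure, ∀ x, q t ≤ x ↔ t ≤ F x := by
    filter_upwards [ae_unifMeasure_mem_Ioo] with t ht using hq t ht
  have := Measure.isProbabilityMeasure_map (μ := unifMeasure) hqm.aemeasurable
  refine ⟨q, ⟨hqm, Measure.ext_of_Iic _ _ fun x => ?_⟩, hae⟩
  rw [Measure.map_apply hqm measurableSet_Iic, ← ProbabilityTheory.ofReal_cdf,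
    ← unifMeasure_Iic (ProbabilityTheory.cdf_le_one μ x)]
  refine measure_congr ?_
  filter_upwards [hae] with t ht
  exact propext (ht x)

end Quantile

/-- Theorem 3.3: `F` is a joint cdf with one-dimensional marginal cdfs `F_k(x) = μ_k(-∞,x]`,
absolutely continuous w.r.t. the product of the marginals, if and only if there are kernels
`g̃_{i_1,…,i_c} : [0,1]^c → ℝ` satisfying A4–A6 (w.r.t. independent uniform `V_i`'s) such that
`F(x₁,…,xₙ) = ∫_0^{F₁(x₁)}⋯∫_0^{Fₙ(xₙ)} (1 + Ũ_n(t₁,…,tₙ)) dt₁⋯dtₙ`. -/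
theorem statement2 (n : ℕ) (μ : Fin n → Measure ℝ) [∀ i, IsProbabilityMeasure (μ i)]
    (F : (Fin n → ℝ) → ℝ) :
    (∃ ν : Measure (Fin n → ℝ), IsProbabilityMeasure ν ∧
        (∀ i, ν.map (fun x => x i) = μ i) ∧
        ν ≪ Measure.pi μ ∧
        ∀ x, F x = (ν (Set.Iic x)).toReal) ↔
      ∃ g : Finset (Fin n) → (Fin n → ℝ) → ℝ,
        IsKernelSystem (fun _ : Fin n => unifMeasure) g ∧
        ∀ x : Fin n → ℝ,
          F x = ∫ t in Set.Iic (fun i => ((μ i) (Set.Iic (x i))).toReal),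
            (1 + Usum g t) ∂Measure.pi (fun _ : Fin n => unifMeasure) := by
  classical
  choose q hq hqF using fun i => exists_quantile (μ i)
  set P : Fin n → Measure ℝ := fun _ => unifMeasure with hP
  have : ∀ i, IsProbabilityMeasure (P i) := fun _ => by rw [hP]; infer_instance
  let Q : (Fin n → ℝ) → Fin n → ℝ := fun t i => q i (t i)
  have hQ : MeasurePreserving Q (Measure.pi P) (Measure.pi μ) := measurePreserving_pi P μ hq
  have hQF : ∀ x : Fin n → ℝ, Q ⁻¹' Set.Iic x =ᵐ[Measure.pi P]
      Set.Iic (fun i => ((μ i) (Set.Iic (x i))).toReal) := fun x => by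
    filter_upwards [ae_all_iff.mpr fun i =>
      (Measure.quasiMeasurePreserving_eval P i).ae (hqF i)] with t ht
    exact propext (forall_congr' fun i => ht i (x i))
  constructor
  · rintro ⟨ν, hν, hνμ, hac, hF⟩
    set f := ν.rnDeriv (Measure.pi μ)
    have hf : Measurable f := Measure.measurable_rnDeriv _ _
    have hfν : (Measure.pi μ).withDensity f = ν := Measure.withDensity_rnDeriv_eq _ _ hac
    have hone : ∫⁻ t, f (Q t) ∂Measure.pi P = 1 := by
      rw [hQ.lintegral_comp hf, ← setLIntegral_univ, ← withDensity_apply _ MeasurableSet.univ,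
        hfν, measure_univ]
    obtain ⟨g, hg, hgf⟩ := exists_isKernelSystem (μ := P) (hf.comp hQ.measurable) hone fun i => by
      have h := lmarginal_compl_singleton_ae_eq_one hf i (by rw [hfν]; exact hνμ i)
      filter_upwards [hQ.quasiMeasurePreserving.ae h] with t ht
      rw [← ht]
      exact lmarginal_comp hq _ hf t
    refine ⟨g, hg, fun x => ?_⟩
    rw [hF, integral_congr_ae (ae_restrict_of_ae hgf), integral_toReal
      (hf.comp hQ.measurable).aemeasurable (ae_restrict_of_ae
        (ae_lt_top (hf.comp hQ.measurable) (by simpa using hone ▸ ENNReal.one_ne_top))),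
      ← setLIntegral_congr (hQF x), ← hfν, withDensity_apply _ measurableSet_Iic,
      ← hQ.setLIntegral_comp_preimage measurableSet_Iic hf]
    rfl
  · rintro ⟨g, hg, hF⟩
    let f : (Fin n → ℝ) → ENNReal := fun t => ENNReal.ofReal (1 + Usum g t)
    have hpre : ∀ i, ∀ B : Set ℝ, MeasurableSet B →
        (Measure.pi P).withDensity f ((fun t => t i) ⁻¹' B) = P i B := fun i B hB => by
      have hB' : MeasurableSet ((fun t : Fin n → ℝ => t i) ⁻¹' B) := measurable_pi_apply i hB
      rw [withDensity_apply _ hB', hg.setLIntegral_one_add_Usum hB' fun S hS => ?_]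
      · exact (measurePreserving_eval P i).measure_preimage hB.nullMeasurableSet
      · obtain ⟨k, hk, hki⟩ := exists_mem_ne (show 1 < S.card by omega) i
        exact ⟨k, hk, fun x t => by simp [Function.update_of_ne hki.symm]⟩
    have hprob : IsProbabilityMeasure ((Measure.pi P).withDensity f) := ⟨by
      rw [withDensity_apply _ MeasurableSet.univ,
        hg.setLIntegral_one_add_Usum MeasurableSet.univ fun S hS => ?_, measure_univ]
      obtain ⟨k, hk⟩ := card_pos.mp (show 0 < S.card by omega)
      exact ⟨k, hk, by simp⟩⟩
    refine ⟨((Measure.pi P).withDensity f).map Q,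
      Measure.isProbabilityMeasure_map hQ.measurable.aemeasurable, fun i => ?_, ?_, fun x => ?_⟩
    · ext B hB
      rw [Measure.map_map (measurable_pi_apply i) hQ.measurable,
        Measure.map_apply ((measurable_pi_apply i).comp hQ.measurable) hB,
        ← (hq i).measure_preimage hB.nullMeasurableSet, ← hpre i _ ((hq i).measurable hB)]
      rfl
    · rw [← hQ.map_eq]
      exact (withDensity_absolutelyContinuous _ _).map hQ.measurable
    · rw [Measure.map_apply hQ.measurable measurableSet_Iic,
        withDensity_apply _ (hQ.measurable measurableSet_Iic), setLIntegral_congr (hQF x), hF,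
        integral_eq_lintegral_of_nonneg_ae (ae_restrict_of_ae hg.one_add_Usum_nonneg)
          hg.measurable_one_add_Usum.aestronglyMeasurable]
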